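/- arXiv:2101.08460 — 9 statements merged into one kernel-verified Lean document; each statement's English description precedes it below -/
import Mathlib

section
/- Let β > 0 and a ≥ 0. Then there exist constants c₁, c₂ > 0 such that for every r ∈ (0,1], c₁ r^{-2β} ≤ ∫₀^∞ t^{-β-1} e^{-a²t} e^{-r²/(4t)} dt ≤ c₂ r^{-2β}. -/
open MeasureTheory Real

/-- After rescaling `t = r² s`, the subordination integral has integrand
`subordinationKernel β (a² r²) s`. -/
noncomputable def subordinationKernel (β b s : ℝ) : ℝ :=
  s ^ (-β - 1) * exp (-b * s) * exp (-1 / (4 * s))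

lemma subordinationKernel_pos (β b : ℝ) {s : ℝ} (hs : 0 < s) :
    0 < subordinationKernel β b s := by
  unfold subordinationKernel
  positivity

lemma subordinationKernel_anti (β : ℝ) {b c s : ℝ} (hbc : b ≤ c) (hs : 0 < s) :
    subordinationKernel β c s ≤ subordinationKernel β b s := by
  unfold subordinationKernel
  gcongr

lemma integrableOn_subordinationKernel_zero {β : ℝ} (hβ : 0 < β) :
    IntegrableOn (subordinationKernel β 0) (Set.Ioi 0) := by
  have h := integrableOn_rpow_mul_exp_neg_mul_rpow (p := 1) (s := β - 1) (b := 1 / 4)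
    (by linarith) one_pos (by norm_num)
  rw [← integrableOn_Ioi_comp_rpow_iff' _ (neg_ne_zero.mpr one_ne_zero)] at h
  refine h.congr_fun (fun s (hs : 0 < s) => ?_) measurableSet_Ioi
  have hpow : s ^ (-1 - 1 : ℝ) * (s ^ (-1 : ℝ)) ^ (β - 1) = s ^ (-β - 1) := by
    rw [← rpow_mul hs.le, ← rpow_add hs]
    ring_nf
  have hexp : -(1 / 4) * (s ^ (-1 : ℝ)) ^ (1 : ℝ) = -1 / (4 * s) := by
    rw [rpow_one, rpow_neg_one]
    field_simp
  simp only [subordinationKernel, smul_eq_mul, hexp]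
  rw [← mul_assoc, hpow]
  simp

lemma integrableOn_subordinationKernel {β b : ℝ} (hβ : 0 < β) (hb : 0 ≤ b) :
    IntegrableOn (subordinationKernel β b) (Set.Ioi 0) := by
  refine (integrableOn_subordinationKernel_zero hβ).mono' ?_ ?_
  · unfold subordinationKernel
    exact Measurable.aestronglyMeasurable (by fun_prop)
  · refine (ae_restrict_mem measurableSet_Ioi).mono fun s (hs : 0 < s) => ?_
    rw [norm_of_nonneg (subordinationKernel_pos β b hs).le]
    exact subordinationKernel_anti β hb hs

lemma integral_subordinationKernel_pos {β b : ℝ} (hβ : 0 < β) (hb : 0 ≤ b) :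
    0 < ∫ s in Set.Ioi (0 : ℝ), subordinationKernel β b s := by
  have hsupp : Set.Ioi 0 ⊆ Function.support (subordinationKernel β b) :=
    fun s hs => (subordinationKernel_pos β b hs).ne'
  rw [setIntegral_pos_iff_support_of_nonneg_ae
    ((ae_restrict_mem measurableSet_Ioi).mono fun s hs => (subordinationKernel_pos β b hs).le)
    (integrableOn_subordinationKernel hβ hb), Set.inter_eq_right.mpr hsupp]
  simp

lemma integral_subordinationKernel_anti {β b c : ℝ} (hβ : 0 < β) (hb : 0 ≤ b) (hbc : b ≤ c) :
    ∫ s in Set.Ioi (0 : ℝ), subordinationKernel β c s ≤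
      ∫ s in Set.Ioi (0 : ℝ), subordinationKernel β b s :=
  setIntegral_mono_on (integrableOn_subordinationKernel hβ (hb.trans hbc))
    (integrableOn_subordinationKernel hβ hb) measurableSet_Ioi
    fun _ hs => subordinationKernel_anti β hbc hs

lemma integral_subordination_eq (β a : ℝ) {r : ℝ} (hr : 0 < r) :
    (∫ t in Set.Ioi (0 : ℝ), t ^ (-β - 1) * exp (-a ^ 2 * t) * exp (-r ^ 2 / (4 * t))) =
      (∫ s in Set.Ioi (0 : ℝ), subordinationKernel β (a ^ 2 * r ^ 2) s) * r ^ (-2 * β) := by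
  have hr2 : 0 < r ^ 2 := by positivity
  have hscale := integral_comp_mul_left_Ioi'
    (fun t : ℝ => t ^ (-β - 1) * exp (-a ^ 2 * t) * exp (-r ^ 2 / (4 * t))) 0 hr2
  rw [mul_zero] at hscale
  rw [← hscale, smul_eq_mul, mul_comm, ← integral_mul_const, ← integral_mul_const]
  refine setIntegral_congr_fun measurableSet_Ioi fun s (hs : 0 < s) => ?_
  have hpow : (r ^ 2 * s) ^ (-β - 1) * r ^ 2 = s ^ (-β - 1) * r ^ (-2 * β) := by
    have h : (r ^ 2) ^ (-β - 1) * r ^ 2 = r ^ (-2 * β) := by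
      rw [← rpow_natCast, ← rpow_mul hr.le, ← rpow_add hr]
      congr 1
      push_cast
      ring
    rw [mul_rpow hr2.le hs.le, ← h]
    ring
  have hexp₁ : -a ^ 2 * (r ^ 2 * s) = -(a ^ 2 * r ^ 2) * s := by ring
  have hexp₂ : -r ^ 2 / (4 * (r ^ 2 * s)) = -1 / (4 * s) := by field_simp
  simp only [subordinationKernel, hexp₁, hexp₂]
  linear_combination exp (-(a ^ 2 * r ^ 2) * s) * exp (-1 / (4 * s)) * hpow

/-- Local two-sided estimate for subordinated heat-kernel integrals: for β > 0, a ≥ 0,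
there are c₁, c₂ > 0 such that for all r ∈ (0,1],
`c₁ r^{-2β} ≤ ∫₀^∞ t^{-β-1} e^{-a²t} e^{-r²/(4t)} dt ≤ c₂ r^{-2β}`. -/
theorem subordination_local_estimate (β a : ℝ) (hβ : 0 < β) (ha : 0 ≤ a) :
    ∃ c₁ c₂ : ℝ, 0 < c₁ ∧ 0 < c₂ ∧ ∀ r : ℝ, r ∈ Set.Ioc (0:ℝ) 1 →
      c₁ * r ^ (-2*β) ≤
        (∫ t in Set.Ioi (0:ℝ), t ^ (-β - 1) * Real.exp (-a^2 * t) * Real.exp (-r^2 / (4*t))) ∧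
      (∫ t in Set.Ioi (0:ℝ), t ^ (-β - 1) * Real.exp (-a^2 * t) * Real.exp (-r^2 / (4*t)))
        ≤ c₂ * r ^ (-2*β) := by
  refine ⟨∫ s in Set.Ioi (0 : ℝ), subordinationKernel β (a ^ 2) s,
    ∫ s in Set.Ioi (0 : ℝ), subordinationKernel β 0 s,
    integral_subordinationKernel_pos hβ (sq_nonneg a),
    integral_subordinationKernel_pos hβ le_rfl, fun r ⟨hr, hr1⟩ => ?_⟩
  have hb : 0 ≤ a ^ 2 * r ^ 2 := by positivity
  have hba : a ^ 2 * r ^ 2 ≤ a ^ 2 :=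
    mul_le_of_le_one_right (sq_nonneg a) (pow_le_one₀ hr.le hr1)
  rw [integral_subordination_eq β a hr]
  exact ⟨by gcongr ?_ * _; exact integral_subordinationKernel_anti hβ hb hba,
    by gcongr ?_ * _; exact integral_subordinationKernel_anti hβ le_rfl hb⟩
end

section
/- Let a > 0, γ ∈ ℝ and κ > 1. Then there exist constants c₁, c₂ > 0 such that for every R ≥ 1, c₁ R^{-γ-1/2} e^{-aR} ≤ ∫_{R/(2aκ)}^{κR/(2a)} t^{-γ-1} e^{-a²t} e^{-R²/(4t)} dt ≤ c₂ R^{-γ-1/2} e^{-aR}. -/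
open MeasureTheory Real

/-- A real power is bounded above and below by positive constants on a compact subinterval of
the positive half-line. -/
theorem exists_rpow_bounds_Icc (r : ℝ) {p q : ℝ} (hp : 0 < p) (hpq : p ≤ q) :
    ∃ m M : ℝ, 0 < m ∧ 0 < M ∧ ∀ s ∈ Set.Icc p q, m ≤ s ^ r ∧ s ^ r ≤ M := by
  have hc : ContinuousOn (fun s : ℝ => s ^ r) (Set.Icc p q) :=
    continuousOn_id.rpow_const fun s hs => Or.inl (hp.trans_le hs.1).ne'
  obtain ⟨x, hx, hmin⟩ := isCompact_Icc.exists_isMinOn (Set.nonempty_Icc.2 hpq) hc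
  obtain ⟨y, hy, hmax⟩ := isCompact_Icc.exists_isMaxOn (Set.nonempty_Icc.2 hpq) hc
  exact ⟨x ^ r, y ^ r, rpow_pos_of_pos (hp.trans_le hx.1) r, rpow_pos_of_pos (hp.trans_le hy.1) r,
    fun s hs => ⟨hmin hs, hmax hs⟩⟩

/-- Completing the square in the exponent of the subordination integrand. -/
theorem exp_mul_exp_eq_complete_square {a R t : ℝ} (ha : a ≠ 0) (ht : t ≠ 0) :
    exp (-a ^ 2 * t) * exp (-R ^ 2 / (4 * t)) =
      exp (-a * R) * exp (-(a ^ 2 * (t - R / (2 * a)) ^ 2 / t)) := by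
  rw [← exp_add, ← exp_add]
  congr 1
  field_simp
  ring

theorem rpow_mul_sqrt_eq {R : ℝ} (hR : 0 < R) (γ : ℝ) :
    R ^ (-γ - 1) * √R = R ^ (-γ - 1 / 2) := by
  rw [sqrt_eq_rpow, ← rpow_add hR]
  congr 1
  ring

theorem integral_le_gaussian {f : ℝ → ℝ} {s : Set ℝ} {C b c : ℝ} (hs : MeasurableSet s)
    (hf : IntegrableOn f s) (hC : 0 ≤ C) (hb : 0 < b)
    (h : ∀ t ∈ s, f t ≤ C * exp (-b * (t - c) ^ 2)) :
    ∫ t in s, f t ≤ C * √(π / b) := by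
  have hg : Integrable fun t : ℝ => C * exp (-b * (t - c) ^ 2) :=
    ((integrable_exp_neg_mul_sq hb).comp_sub_right c).const_mul C
  calc ∫ t in s, f t ≤ ∫ t in s, C * exp (-b * (t - c) ^ 2) :=
        setIntegral_mono_on hf hg.integrableOn hs h
    _ ≤ ∫ t, C * exp (-b * (t - c) ^ 2) :=
        setIntegral_le_integral hg (.of_forall fun t => by positivity)
    _ = C * √(π / b) := by
        rw [integral_const_mul, integral_sub_right_eq_self (fun t => exp (-b * t ^ 2)) c,
          integral_gaussian]

theorem mul_length_le_integral {f : ℝ → ℝ} {p q x y C : ℝ} (hxy : x ≤ y)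
    (hsub : Set.Icc x y ⊆ Set.Icc p q) (hf : IntegrableOn f (Set.Icc p q))
    (hf0 : ∀ t ∈ Set.Icc p q, 0 ≤ f t) (h : ∀ t ∈ Set.Icc x y, C ≤ f t) :
    C * (y - x) ≤ ∫ t in Set.Icc p q, f t := by
  calc C * (y - x) = C * volume.real (Set.Icc x y) := by rw [Real.volume_real_Icc_of_le hxy]
    _ ≤ ∫ t in Set.Icc x y, f t :=
        setIntegral_ge_of_const_le_real measurableSet_Icc (by simp) h (hf.mono_set hsub)
    _ ≤ ∫ t in Set.Icc p q, f t :=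
        setIntegral_mono_set hf ((ae_restrict_iff' measurableSet_Icc).2 (.of_forall hf0))
          hsub.eventuallyLE

/-- Two-sided Laplace-method estimate for the middle range: for a > 0, γ ∈ ℝ, κ > 1,
there are c₁, c₂ > 0 such that for all R ≥ 1,
`c₁ R^{-γ-1/2} e^{-aR} ≤ ∫_{R/(2aκ)}^{κR/(2a)} t^{-γ-1} e^{-a²t} e^{-R²/(4t)} dt
  ≤ c₂ R^{-γ-1/2} e^{-aR}`. -/
theorem subordination_middle_estimate (a γ κ : ℝ) (ha : 0 < a) (hκ : 1 < κ) :
    ∃ c₁ c₂ : ℝ, 0 < c₁ ∧ 0 < c₂ ∧ ∀ R : ℝ, 1 ≤ R →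
      c₁ * R ^ (-γ - 1/2) * Real.exp (-a * R) ≤
        (∫ t in Set.Icc (R/(2*a*κ)) (κ*R/(2*a)),
          t ^ (-γ - 1) * Real.exp (-a^2 * t) * Real.exp (-R^2 / (4*t))) ∧
      (∫ t in Set.Icc (R/(2*a*κ)) (κ*R/(2*a)),
          t ^ (-γ - 1) * Real.exp (-a^2 * t) * Real.exp (-R^2 / (4*t)))
        ≤ c₂ * R ^ (-γ - 1/2) * Real.exp (-a * R) := by
  have hκ0 : 0 < κ := one_pos.trans hκ
  have hκ1 : 0 < κ - 1 := sub_pos.2 hκ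
  have hpq : 1 / (2 * a * κ) ≤ κ / (2 * a) := by
    rw [div_le_div_iff₀ (by positivity) (by positivity)]
    have : 1 ≤ κ * κ := by nlinarith
    nlinarith
  obtain ⟨m, M, hm, hM, hmM⟩ := exists_rpow_bounds_Icc (-γ - 1) (by positivity) hpq
  set δ := (κ - 1) / (2 * a) with hδ
  have hδ0 : 0 < δ := by positivity
  refine ⟨m * exp (-(2 * a ^ 3 * δ ^ 2)) * δ, M * √(π * κ / (2 * a ^ 3)), by positivity,
    by positivity, fun R hR => ?_⟩
  have hR0 : 0 < R := one_pos.trans_le hR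
  have hpos : ∀ t ∈ Set.Icc (R / (2 * a * κ)) (κ * R / (2 * a)), 0 < t := fun t ht =>
    (show 0 < R / (2 * a * κ) by positivity).trans_le ht.1
  have hpow : ∀ t ∈ Set.Icc (R / (2 * a * κ)) (κ * R / (2 * a)),
      m * R ^ (-γ - 1) ≤ t ^ (-γ - 1) ∧ t ^ (-γ - 1) ≤ M * R ^ (-γ - 1) := by
    intro t ht
    have hs := hmM (t / R) ⟨(le_div_iff₀ hR0).2 ((div_mul_eq_mul_div _ _ _).trans_le
        (by simpa using ht.1)), (div_le_iff₀ hR0).2 (ht.2.trans_eq (by ring))⟩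
    rw [div_rpow (hpos t ht).le hR0.le] at hs
    have hRp : 0 < R ^ (-γ - 1) := rpow_pos_of_pos hR0 _
    rwa [le_div_iff₀ hRp, div_le_iff₀ hRp] at hs
  have hint : IntegrableOn (fun t : ℝ => t ^ (-γ - 1) * exp (-a ^ 2 * t) * exp (-R ^ 2 / (4 * t)))
      (Set.Icc (R / (2 * a * κ)) (κ * R / (2 * a))) := by
    refine ContinuousOn.integrableOn_Icc fun t ht => ContinuousAt.continuousWithinAt ?_
    have ht0 := (hpos t ht).ne'
    have h4 : 4 * t ≠ 0 := by positivity
    exact ((continuousAt_id.rpow_const (Or.inl ht0)).mul (by fun_prop)).mul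
      (by fun_prop (disch := assumption))
  constructor
  · have hRR : √R ≤ R := by nlinarith [one_le_sqrt.2 hR, mul_self_sqrt hR0.le]
    have hend : R / (2 * a) + δ * √R ≤ κ * R / (2 * a) :=
      calc R / (2 * a) + δ * √R ≤ R / (2 * a) + δ * R := by gcongr
        _ = κ * R / (2 * a) := by rw [hδ]; ring
    have hsub : Set.Icc (R / (2 * a)) (R / (2 * a) + δ * √R) ⊆
        Set.Icc (R / (2 * a * κ)) (κ * R / (2 * a)) := by
      refine Set.Icc_subset_Icc ?_ hend
      exact div_le_div_of_nonneg_left hR0.le (by positivity)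
        (le_mul_of_one_le_right (by positivity) hκ.le)
    have key := mul_length_le_integral (C := m * R ^ (-γ - 1) *
        (exp (-a * R) * exp (-(2 * a ^ 3 * δ ^ 2)))) (le_add_of_nonneg_right (by positivity)) hsub
      hint (fun t ht => by have := hpos t ht; positivity) fun t ht => by
        have ht' := hsub ht
        have ht0 := hpos t ht'
        rw [mul_assoc (t ^ _), exp_mul_exp_eq_complete_square ha.ne' ht0.ne']
        have hu : (t - R / (2 * a)) ^ 2 ≤ δ ^ 2 * R := by
          calc (t - R / (2 * a)) ^ 2 ≤ (δ * √R) ^ 2 := by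
                gcongr
                · linarith [ht.1]
                · linarith [ht.2]
            _ = δ ^ 2 * R := by rw [mul_pow, sq_sqrt hR0.le]
        have hRt : R ≤ 2 * a * t := by
          have := ht.1
          rw [div_le_iff₀ (by positivity)] at this
          linarith
        have he : a ^ 2 * (t - R / (2 * a)) ^ 2 / t ≤ 2 * a ^ 3 * δ ^ 2 := by
          rw [div_le_iff₀ ht0]
          calc a ^ 2 * (t - R / (2 * a)) ^ 2 ≤ a ^ 2 * (δ ^ 2 * (2 * a * t)) := by
                gcongr; exact hu.trans (by gcongr)
            _ = 2 * a ^ 3 * δ ^ 2 * t := by ring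
        gcongr
        exact (hpow t ht').1
    refine le_trans (le_of_eq ?_) key
    rw [← rpow_mul_sqrt_eq hR0]
    ring
  · have key := integral_le_gaussian (C := M * R ^ (-γ - 1) * exp (-a * R))
      (b := 2 * a ^ 3 / (κ * R)) (c := R / (2 * a)) measurableSet_Icc hint (by positivity)
      (by positivity) fun t ht => by
        have ht0 := hpos t ht
        rw [mul_assoc, exp_mul_exp_eq_complete_square ha.ne' ht0.ne', ← mul_assoc]
        have hRt : 2 * a * t ≤ κ * R := by
          have := ht.2
          rw [le_div_iff₀ (by positivity)] at this
          linarith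
        have he : 2 * a ^ 3 / (κ * R) * (t - R / (2 * a)) ^ 2 ≤
            a ^ 2 * (t - R / (2 * a)) ^ 2 / t := by
          rw [div_mul_eq_mul_div, div_le_div_iff₀ (by positivity) ht0]
          calc 2 * a ^ 3 * (t - R / (2 * a)) ^ 2 * t
              = a ^ 2 * (t - R / (2 * a)) ^ 2 * (2 * a * t) := by ring
            _ ≤ a ^ 2 * (t - R / (2 * a)) ^ 2 * (κ * R) := by gcongr
        gcongr
        · exact (hpow t ht).2
        · rwa [neg_mul, neg_le_neg_iff]
    refine key.trans_eq ?_
    rw [← rpow_mul_sqrt_eq hR0,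
      show π / (2 * a ^ 3 / (κ * R)) = π * κ / (2 * a ^ 3) * R by field_simp,
      sqrt_mul (by positivity)]
    ring
end

section
/- Let a > 0, γ ∈ ℝ and κ > 4. Then there exist constants C > 0 and η > 0 such that for every R ≥ 1, ∫_{κR/(2a)}^{∞} t^{-γ-1} e^{-a²t} e^{-R²/(4t)} dt ≤ C e^{-(a+η)R}. -/
open MeasureTheory Real

/-- Away from the origin, a real power times a decaying exponential is integrable. -/
theorem integrableOn_Ici_rpow_mul_exp_neg_mul (s : ℝ) {b c : ℝ} (hb : 0 < b) (hc : 0 < c) :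
    IntegrableOn (fun t : ℝ => t ^ s * Real.exp (-b * t)) (Set.Ici c) := by
  rw [integrableOn_Ici_iff_integrableOn_Ioi]
  refine integrable_of_isBigO_exp_neg (b := b / 2) (half_pos hb) ?_ ?_
  · refine ContinuousOn.mul (fun t ht => ?_) (by fun_prop)
    exact (Real.continuousAt_rpow_const t s
      (Or.inl (hc.trans_le ht).ne')).continuousWithinAt
  · refine (((isLittleO_rpow_exp_pos_mul_atTop s (half_pos hb)).isBigO).mul
      (Asymptotics.isBigO_refl (fun t : ℝ => Real.exp (-b * t)) Filter.atTop)).congr_right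
      fun t => ?_
    rw [← Real.exp_add]
    ring_nf

/-- Tail estimate: for a > 0, γ ∈ ℝ, κ > 4, there exist C > 0 and η > 0 such that for all R ≥ 1,
`∫_{κR/(2a)}^∞ t^{-γ-1} e^{-a²t} e^{-R²/(4t)} dt ≤ C e^{-(a+η)R}`. -/
theorem subordination_tail_estimate (a γ κ : ℝ) (ha : 0 < a) (hκ : 4 < κ) :
    ∃ C η : ℝ, 0 < C ∧ 0 < η ∧ ∀ R : ℝ, 1 ≤ R →
      (∫ t in Set.Ici (κ*R/(2*a)),
          t ^ (-γ - 1) * Real.exp (-a^2 * t) * Real.exp (-R^2 / (4*t)))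
        ≤ C * Real.exp (-(a + η) * R) := by
  have hc : 0 < κ / (2 * a) := by positivity
  set g : ℝ → ℝ := fun t => t ^ (-γ - 1) * Real.exp (-(a ^ 2 / 4) * t)
  have hg : IntegrableOn g (Set.Ici (κ / (2 * a))) :=
    integrableOn_Ici_rpow_mul_exp_neg_mul _ (by positivity) hc
  have hg0 : ∀ t ∈ Set.Ici (κ / (2 * a)), 0 ≤ g t := fun t ht =>
    mul_nonneg (Real.rpow_nonneg (hc.le.trans ht) _) (Real.exp_pos _).le
  have hI : 0 ≤ ∫ t in Set.Ici (κ / (2 * a)), g t :=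
    setIntegral_nonneg measurableSet_Ici hg0
  refine ⟨(∫ t in Set.Ici (κ / (2 * a)), g t) + 1, a / 2, by positivity, by positivity,
    fun R hR => ?_⟩
  have hsub : Set.Ici (κ * R / (2 * a)) ⊆ Set.Ici (κ / (2 * a)) := by
    refine Set.Ici_subset_Ici.2 ?_
    gcongr
    nlinarith
  calc _ ≤ ∫ t in Set.Ici (κ * R / (2 * a)), g t * Real.exp (-(a + a / 2) * R) := by
        refine integral_mono_of_nonneg ?_ ((hg.mono_set hsub).mul_const _) ?_
        · filter_upwards [ae_restrict_mem measurableSet_Ici] with t ht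
          have ht0 : 0 ≤ t := hc.le.trans (hsub ht)
          simp only [Pi.zero_apply]
          positivity
        · filter_upwards [ae_restrict_mem measurableSet_Ici] with t ht
          have ht0 : 0 < t := hc.trans_le (hsub ht)
          have hκt : κ * R ≤ t * (2 * a) := (div_le_iff₀ (by positivity)).1 ht
          have hRt : 2 * R ≤ a * t := by nlinarith
          have hq : -R ^ 2 / (4 * t) ≤ 0 :=
            div_nonpos_of_nonpos_of_nonneg (by nlinarith [sq_nonneg R]) (by positivity)
          simp only [g]
          rw [mul_assoc, mul_assoc, ← Real.exp_add, ← Real.exp_add]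
          refine mul_le_mul_of_nonneg_left (Real.exp_le_exp.2 ?_) (by positivity)
          nlinarith [mul_le_mul_of_nonneg_left hRt ha.le]
    _ = (∫ t in Set.Ici (κ * R / (2 * a)), g t) * Real.exp (-(a + a / 2) * R) :=
        integral_mul_const _ _
    _ ≤ _ := by
        gcongr
        have := setIntegral_mono_set hg
          ((ae_restrict_mem measurableSet_Ici).mono hg0) hsub.eventuallyLE
        linarith
end

section
/- Let a > 0, δ > 0 and κ > 4. Then there exist constants C > 0 and ε > 0 such that for every R ≥ 1, ∫₀^{R/(2aκ)} t^{-1-δ} e^{-R²/(4t)} dt ≤ C e^{-(a+ε)R}. -/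
open MeasureTheory Real

/-- For `p > 0` the power `s ^ p` is dominated by `p ^ p * exp s` on `s ≥ 0`, here in the form
`(c * s) ^ p ≤ (c * p) ^ p * exp s`. -/
lemma mul_rpow_le_mul_rpow_mul_exp {c p s : ℝ} (hc : 0 ≤ c) (hp : 0 < p) (hs : 0 ≤ s) :
    (c * s) ^ p ≤ (c * p) ^ p * exp s := by
  have h : s / p ≤ exp (s / p) := by linarith [add_one_le_exp (s / p)]
  calc (c * s) ^ p = (c * p * (s / p)) ^ p := by congr 1; field_simp
    _ ≤ (c * p * exp (s / p)) ^ p := by gcongr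
    _ = (c * p) ^ p * exp s := by
        rw [mul_rpow (by positivity) (exp_pos _).le, ← exp_mul, div_mul_cancel₀ _ hp.ne']

/-- Half of the Gaussian exponent absorbs the singularity of `t ^ (-p)` at `0`. -/
lemma rpow_neg_mul_exp_le {p R t : ℝ} (hp : 1 ≤ p) (hR : 1 ≤ R) (ht : 0 < t) :
    t ^ (-p) * exp (-R ^ 2 / (4 * t)) ≤ (8 * p) ^ p / R * exp (-(R ^ 2 / (8 * t))) := by
  have hR0 : 0 < R := by linarith
  have hp0 : 0 < p := by linarith
  have h1 : t ^ (-p) ≤ (8 / R ^ 2 * p) ^ p * exp (R ^ 2 / (8 * t)) := by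
    have h := mul_rpow_le_mul_rpow_mul_exp (c := 8 / R ^ 2) (p := p) (s := R ^ 2 / (8 * t))
      (by positivity) hp0 (by positivity)
    have e : 8 / R ^ 2 * (R ^ 2 / (8 * t)) = t⁻¹ := by field_simp
    rwa [e, inv_rpow ht.le, ← rpow_neg ht.le] at h
  have h2 : (8 / R ^ 2 * p) ^ p ≤ (8 * p) ^ p / R := by
    have h3 : R ≤ (R ^ 2) ^ p :=
      calc R ≤ R ^ 2 := by nlinarith
        _ = (R ^ 2) ^ (1 : ℝ) := (rpow_one _).symm
        _ ≤ (R ^ 2) ^ p := rpow_le_rpow_of_exponent_le (by nlinarith) hp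
    rw [div_mul_eq_mul_div, div_rpow (by positivity) (by positivity)]
    gcongr
  calc t ^ (-p) * exp (-R ^ 2 / (4 * t))
      ≤ (8 * p) ^ p / R * exp (R ^ 2 / (8 * t)) * exp (-R ^ 2 / (4 * t)) := by
        gcongr
        exact h1.trans (by gcongr)
    _ = (8 * p) ^ p / R * exp (-(R ^ 2 / (8 * t))) := by
        rw [mul_assoc, ← exp_add]
        congr 2
        field_simp
        ring

/-- Near-zero estimate: for a > 0, δ > 0, κ > 4, there exist C > 0 and ε > 0 such that for
all R ≥ 1, `∫₀^{R/(2aκ)} t^{-1-δ} e^{-R²/(4t)} dt ≤ C e^{-(a+ε)R}`. -/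
theorem subordination_head_estimate (a δ κ : ℝ) (ha : 0 < a) (hδ : 0 < δ) (hκ : 4 < κ) :
    ∃ C ε : ℝ, 0 < C ∧ 0 < ε ∧ ∀ R : ℝ, 1 ≤ R →
      (∫ t in Set.Ioc (0:ℝ) (R/(2*a*κ)),
          t ^ (-1 - δ) * Real.exp (-R^2 / (4*t)))
        ≤ C * Real.exp (-(a + ε) * R) := by
  have hκ0 : 0 < κ := by linarith
  refine ⟨(8 * (1 + δ)) ^ (1 + δ) / (2 * a * κ), a * (κ / 4 - 1), by positivity,
    mul_pos ha (by linarith), fun R hR => ?_⟩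
  have hR0 : 0 < R := by linarith
  have hbound : ∀ t ∈ Set.Ioc (0:ℝ) (R / (2 * a * κ)),
      ‖t ^ (-1 - δ) * exp (-R ^ 2 / (4 * t))‖ ≤
        (8 * (1 + δ)) ^ (1 + δ) / R * exp (-(a + a * (κ / 4 - 1)) * R) := by
    rintro t ⟨ht, htR⟩
    rw [norm_of_nonneg (by positivity), show -1 - δ = -(1 + δ) by ring]
    refine (rpow_neg_mul_exp_le (by linarith) hR ht).trans ?_
    gcongr
    rw [le_div_iff₀ (by positivity)] at htR
    have : a * κ / 4 * R ≤ R ^ 2 / (8 * t) := by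
      rw [le_div_iff₀ (by positivity)]
      nlinarith
    linarith
  have h := norm_setIntegral_le_of_norm_le_const (μ := volume) measure_Ioc_lt_top hbound
  rw [volume_real_Ioc_of_le (by positivity)] at h
  refine (le_norm_self _).trans (h.trans_eq ?_)
  field_simp
  ring
end

section
/- Let l ≥ 2 be a real number and let ν ∈ (0, π/2]. Then there exist constants c₁, c₂ > 0 such that for every r ≥ 1, c₁ r^{-(l-1)/2} ≤ ∫₀^ν (sin ξ)^{l-2} e^{-r(1-\cos ξ)} dξ ≤ c₂ r^{-(l-1)/2}. -/
open MeasureTheory Real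

/-- For `s ≥ 0` the angular integrand `(sin ξ) ^ s * e^{-r (1 - cos ξ)}` is integrable on bounded
intervals. -/
lemma integrableOn_sin_rpow_mul_exp_cos {s : ℝ} (hs : 0 ≤ s) (r a b : ℝ) :
    IntegrableOn (fun ξ : ℝ => sin ξ ^ s * exp (-r * (1 - cos ξ))) (Set.Ioo a b) := by
  have hc : Continuous fun ξ : ℝ => sin ξ ^ s * exp (-r * (1 - cos ξ)) :=
    (continuous_sin.rpow_const fun _ => Or.inr hs).mul (by fun_prop)
  exact (hc.integrableOn_Icc (a := a) (b := b)).mono_set Set.Ioo_subset_Icc_self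

/-- Gamma-function upper bound for the angular integral. -/
lemma setIntegral_sin_rpow_mul_exp_cos_le {s ν r : ℝ} (hs : 0 ≤ s) (hν : ν ≤ π) (hr : 0 < r) :
    ∫ ξ in Set.Ioo 0 ν, sin ξ ^ s * exp (-r * (1 - cos ξ)) ≤
      (2 / π ^ 2) ^ (-(s + 1) / 2) * (1 / 2) * Gamma ((s + 1) / 2) * r ^ (-(s + 1) / 2) := by
  have hb : 0 < 2 / π ^ 2 * r := by positivity
  have hint := integrableOn_rpow_mul_exp_neg_mul_rpow (s := s) (by linarith) two_pos hb
  calc ∫ ξ in Set.Ioo 0 ν, sin ξ ^ s * exp (-r * (1 - cos ξ))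
      ≤ ∫ ξ in Set.Ioo 0 ν, ξ ^ s * exp (-(2 / π ^ 2 * r) * ξ ^ (2 : ℝ)) := by
        refine setIntegral_mono_on (integrableOn_sin_rpow_mul_exp_cos hs r 0 ν)
          (hint.mono_set Set.Ioo_subset_Ioi_self) measurableSet_Ioo fun ξ hξ => ?_
        have hξπ : ξ ≤ π := hξ.2.le.trans hν
        have hsin : 0 ≤ sin ξ := sin_nonneg_of_nonneg_of_le_pi hξ.1.le hξπ
        have hcos := cos_le_one_sub_mul_cos_sq (x := ξ) (by rwa [abs_of_pos hξ.1])
        refine mul_le_mul (rpow_le_rpow hsin (sin_le hξ.1.le) hs) (exp_le_exp.2 ?_)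
          (exp_pos _).le (rpow_nonneg hξ.1.le _)
        rw [rpow_two]
        nlinarith
    _ ≤ ∫ ξ in Set.Ioi 0, ξ ^ s * exp (-(2 / π ^ 2 * r) * ξ ^ (2 : ℝ)) := by
        refine setIntegral_mono_set hint ?_ Set.Ioo_subset_Ioi_self.eventuallyLE
        filter_upwards [ae_restrict_mem measurableSet_Ioi] with ξ hξ
        exact mul_nonneg (rpow_nonneg (le_of_lt hξ) _) (exp_pos _).le
    _ = _ := by
        rw [integral_rpow_mul_exp_neg_mul_rpow two_pos (by linarith) hb,
          mul_rpow (by positivity) hr.le]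
        ring

/-- Lower bound for the angular integral, from the contribution of `ξ < ν / √r`. -/
lemma le_setIntegral_sin_rpow_mul_exp_cos {s ν r : ℝ} (hs : 0 ≤ s) (hν0 : 0 < ν)
    (hν : ν ≤ π / 2) (hr : 1 ≤ r) :
    (2 / π) ^ s * exp (-(ν ^ 2 / 2)) * (ν ^ (s + 1) / (s + 1)) * r ^ (-(s + 1) / 2) ≤
      ∫ ξ in Set.Ioo 0 ν, sin ξ ^ s * exp (-r * (1 - cos ξ)) := by
  have hr0 : 0 < r := by linarith
  set a : ℝ := ν * r ^ (-(1 / 2) : ℝ) with ha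
  have ha0 : 0 < a := by positivity
  have haν : a ≤ ν :=
    mul_le_of_le_one_right hν0.le (rpow_le_one_of_one_le_of_nonpos hr (by norm_num))
  have hra : r * a ^ 2 = ν ^ 2 := by
    rw [ha, mul_pow, ← rpow_natCast (r ^ _), ← rpow_mul hr0.le]
    norm_num [rpow_neg_one]
    field_simp
  have hapow : a ^ (s + 1) = ν ^ (s + 1) * r ^ (-(s + 1) / 2) := by
    rw [ha, mul_rpow hν0.le (by positivity), ← rpow_mul hr0.le]
    ring_nf
  have hpow : ∫ ξ in Set.Ioo 0 a, ξ ^ s = a ^ (s + 1) / (s + 1) := by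
    rw [← integral_Ioc_eq_integral_Ioo, ← intervalIntegral.integral_of_le ha0.le,
      integral_rpow (Or.inl (by linarith)), zero_rpow (by linarith), sub_zero]
  have hint : IntegrableOn (fun ξ : ℝ => ξ ^ s) (Set.Ioo 0 a) :=
    ((continuous_id.rpow_const fun _ => Or.inr hs).integrableOn_Icc).mono_set
      Set.Ioo_subset_Icc_self
  calc (2 / π) ^ s * exp (-(ν ^ 2 / 2)) * (ν ^ (s + 1) / (s + 1)) * r ^ (-(s + 1) / 2)
      = ∫ ξ in Set.Ioo 0 a, (2 / π) ^ s * exp (-(ν ^ 2 / 2)) * ξ ^ s := by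
        rw [integral_const_mul, hpow, hapow]
        ring
    _ ≤ ∫ ξ in Set.Ioo 0 a, sin ξ ^ s * exp (-r * (1 - cos ξ)) := by
        refine setIntegral_mono_on (hint.const_mul _)
          (integrableOn_sin_rpow_mul_exp_cos hs r 0 a) measurableSet_Ioo fun ξ hξ => ?_
        have hsin := mul_le_sin hξ.1.le (hξ.2.le.trans (haν.trans hν))
        have hcos := one_sub_sq_div_two_le_cos (x := ξ)
        have hsq : r * ξ ^ 2 ≤ ν ^ 2 :=
          hra ▸ mul_le_mul_of_nonneg_left (pow_le_pow_left₀ hξ.1.le hξ.2.le 2) hr0.le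
        have hξ0 := hξ.1
        rw [mul_right_comm, ← mul_rpow (by positivity) hξ0.le]
        refine mul_le_mul (rpow_le_rpow (by positivity) hsin hs) (exp_le_exp.2 ?_)
          (exp_pos _).le (rpow_nonneg (le_trans (by positivity) hsin) _)
        nlinarith
    _ ≤ _ := by
        refine setIntegral_mono_set (integrableOn_sin_rpow_mul_exp_cos hs r 0 ν) ?_
          (Set.Ioo_subset_Ioo_right haν).eventuallyLE
        filter_upwards [ae_restrict_mem measurableSet_Ioo] with ξ hξ
        exact mul_nonneg (rpow_nonneg (sin_nonneg_of_nonneg_of_le_pi hξ.1.le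
          (by linarith [hξ.2, pi_pos])) _) (exp_pos _).le

/-- Laplace-type angular estimate: for a real l ≥ 2 and ν ∈ (0, π/2], there exist
c₁, c₂ > 0 such that for all r ≥ 1,
`c₁ r^{-(l-1)/2} ≤ ∫₀^ν (sin ξ)^{l-2} e^{-r(1-cos ξ)} dξ ≤ c₂ r^{-(l-1)/2}`. -/
theorem angular_laplace_estimate (l ν : ℝ) (hl : 2 ≤ l) (hν0 : 0 < ν) (hν : ν ≤ Real.pi / 2) :
    ∃ c₁ c₂ : ℝ, 0 < c₁ ∧ 0 < c₂ ∧ ∀ r : ℝ, 1 ≤ r →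
      c₁ * r ^ (-(l - 1)/2) ≤
        (∫ ξ in Set.Ioo (0:ℝ) ν, (Real.sin ξ) ^ (l - 2) * Real.exp (-r * (1 - Real.cos ξ))) ∧
      (∫ ξ in Set.Ioo (0:ℝ) ν, (Real.sin ξ) ^ (l - 2) * Real.exp (-r * (1 - Real.cos ξ)))
        ≤ c₂ * r ^ (-(l - 1)/2) := by
  have hs : 0 ≤ l - 2 := by linarith
  have hexp : l - 1 = l - 2 + 1 := by ring
  refine ⟨(2 / π) ^ (l - 2) * exp (-(ν ^ 2 / 2)) * (ν ^ (l - 2 + 1) / (l - 2 + 1)),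
    (2 / π ^ 2) ^ (-(l - 2 + 1) / 2) * (1 / 2) * Gamma ((l - 2 + 1) / 2),
    by positivity, mul_pos (by positivity) (Gamma_pos_of_pos (by positivity)), fun r hr => ?_⟩
  rw [hexp]
  exact ⟨le_setIntegral_sin_rpow_mul_exp_cos hs hν0 hν hr,
    setIntegral_sin_rpow_mul_exp_cos_le hs (by linarith [pi_pos]) (by linarith)⟩
end

section
/- Let σ ∈ (0,1) and suppose ψ : ℝ → ℝ is twice differentiable, satisfies (1+t²)·ψ''(t) + (2σ+3)·t·ψ'(t) + (2σ+1)·ψ(t) = 0 for all t ∈ ℝ, and satisfies ∫_ℝ ψ(t)² (1+t²)^{σ+1/2} dt < ∞. Then ψ(t) = ψ(0)·(1+t²)^{-σ-1/2} for all t ∈ ℝ. -/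
open MeasureTheory Real

lemma hasDerivAt_one_add_sq_rpow (a t : ℝ) :
    HasDerivAt (fun t : ℝ => (1 + t ^ 2) ^ a) (2 * a * t * (1 + t ^ 2) ^ (a - 1)) t := by
  have hp : HasDerivAt (fun t : ℝ => 1 + t ^ 2) (2 * t) t := by
    simpa using (hasDerivAt_pow 2 t).const_add 1
  convert hp.rpow_const (p := a) (Or.inl (by positivity)) using 1
  ring

/-- A primitive of `(1 + t²)^{σ - 1/2}` grows at least like `(1 + t²)^{σ/2}` on `[0, ∞)`. -/
lemma one_add_sq_rpow_sub_one_le_of_hasDerivAt {σ : ℝ} (hσ0 : 0 < σ) (hσ1 : σ ≤ 1) {f : ℝ → ℝ}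
    (hf : ∀ t, HasDerivAt f ((1 + t ^ 2) ^ (σ - 1 / 2)) t) {t : ℝ} (ht : 0 ≤ t) :
    (1 + t ^ 2) ^ (σ / 2) - 1 ≤ f t - f 0 := by
  have hg : ∀ t, HasDerivAt (fun t => f t - (1 + t ^ 2) ^ (σ / 2))
      ((1 + t ^ 2) ^ (σ - 1 / 2) - 2 * (σ / 2) * t * (1 + t ^ 2) ^ (σ / 2 - 1)) t :=
    fun t => (hf t).sub (hasDerivAt_one_add_sq_rpow _ t)
  have hmono : MonotoneOn (fun t => f t - (1 + t ^ 2) ^ (σ / 2)) (Set.Ici 0) := by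
    refine monotoneOn_of_deriv_nonneg (convex_Ici 0)
      (fun t _ => (hg t).continuousAt.continuousWithinAt)
      (fun t _ => (hg t).differentiableAt.differentiableWithinAt) fun t ht => ?_
    rw [interior_Ici, Set.mem_Ioi] at ht
    rw [(hg t).deriv, sub_nonneg]
    have hp : (1 : ℝ) ≤ 1 + t ^ 2 := by nlinarith
    have htp : t ≤ (1 + t ^ 2) ^ (1 / 2 : ℝ) := by
      rw [← sqrt_eq_rpow]
      exact le_sqrt_of_sq_le (by linarith)
    calc 2 * (σ / 2) * t * (1 + t ^ 2) ^ (σ / 2 - 1)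
        ≤ (1 + t ^ 2) ^ (1 / 2 : ℝ) * (1 + t ^ 2) ^ (σ / 2 - 1) := by
          gcongr
          nlinarith
      _ = (1 + t ^ 2) ^ (1 / 2 + (σ / 2 - 1)) := (rpow_add (by positivity) _ _).symm
      _ ≤ (1 + t ^ 2) ^ (σ - 1 / 2) := rpow_le_rpow_of_exponent_le hp (by linarith)
  have := hmono (Set.mem_Ici.2 le_rfl) ht ht
  norm_num at this
  linarith

/-- A primitive of `(1 + t²)^{σ - 1/2}` is not square-integrable for the weight
`(1 + t²)^{-σ - 1/2}`. -/
lemma not_integrable_sq_mul_of_hasDerivAt {σ : ℝ} (hσ0 : 0 < σ) (hσ1 : σ ≤ 1) {f : ℝ → ℝ}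
    (hf : ∀ t, HasDerivAt f ((1 + t ^ 2) ^ (σ - 1 / 2)) t) :
    ¬ Integrable (fun t : ℝ => f t ^ 2 * (1 + t ^ 2) ^ (-σ - 1 / 2)) := by
  intro hint
  obtain ⟨T, hT⟩ := Filter.eventually_atTop.1
    ((tendsto_rpow_atTop hσ0).eventually_ge_atTop (2 * (1 - f 0)))
  refine not_integrableOn_Ioi_inv (a := max T 1)
    (Integrable.mono' (hint.integrableOn.const_mul 8) (by fun_prop) ?_)
  filter_upwards [ae_restrict_mem measurableSet_Ioi] with t ht
  obtain ⟨hTt, h1t⟩ := max_lt_iff.1 (Set.mem_Ioi.1 ht)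
  have ht0 : 0 < t := by linarith
  have hlow := one_add_sq_rpow_sub_one_le_of_hasDerivAt hσ0 hσ1 hf ht0.le
  have hpow : t ^ σ ≤ (1 + t ^ 2) ^ (σ / 2) := by
    calc t ^ σ = (t ^ 2) ^ (σ / 2) := by
          rw [← rpow_natCast, ← rpow_mul ht0.le]
          congr 1
          push_cast
          ring
      _ ≤ _ := by gcongr; linarith
  have hhalf : (1 + t ^ 2) ^ (σ / 2) / 2 ≤ f t := by linarith [hT t hTt.le]
  have hsq : (1 + t ^ 2) ^ σ / 4 ≤ f t ^ 2 := by
    calc (1 + t ^ 2) ^ σ / 4 = ((1 + t ^ 2) ^ (σ / 2) / 2) ^ 2 := by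
          rw [div_pow, ← rpow_mul_natCast (by positivity)]
          norm_num
      _ ≤ f t ^ 2 := by gcongr
  have hsqrt : √(1 + t ^ 2) ≤ 2 * t := sqrt_le_iff.2 ⟨by positivity, by nlinarith⟩
  rw [norm_of_nonneg (by positivity)]
  calc t⁻¹ = 2 * (2 * t)⁻¹ := by field_simp
    _ ≤ 2 * (√(1 + t ^ 2))⁻¹ := by gcongr
    _ = 8 * ((1 + t ^ 2) ^ σ / 4 * (1 + t ^ 2) ^ (-σ - 1 / 2)) := by
        rw [sqrt_eq_rpow, ← rpow_neg (by positivity), div_mul_eq_mul_div,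
          ← rpow_add (by positivity)]
        ring_nf
    _ ≤ 8 * (f t ^ 2 * (1 + t ^ 2) ^ (-σ - 1 / 2)) := by gcongr

/-- The equation is exact: `(1 + t²) ψ' + (2σ + 1) t ψ` is a first integral. -/
lemma exists_hasDerivAt_mul_one_add_sq_rpow {σ : ℝ} {ψ : ℝ → ℝ}
    (hψ : Differentiable ℝ ψ) (hψ' : Differentiable ℝ (deriv ψ))
    (hODE : ∀ t : ℝ,
      (1 + t^2) * deriv (deriv ψ) t + (2*σ + 3) * t * deriv ψ t + (2*σ + 1) * ψ t = 0) :
    ∃ c : ℝ, ∀ t, HasDerivAt (fun t => ψ t * (1 + t ^ 2) ^ (σ + 1 / 2))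
      (c * (1 + t ^ 2) ^ (σ - 1 / 2)) t := by
  have hF : ∀ t, HasDerivAt (fun t => (1 + t ^ 2) * deriv ψ t + (2 * σ + 1) * (t * ψ t)) 0 t := by
    intro t
    have hp : HasDerivAt (fun t : ℝ => 1 + t ^ 2) (2 * t) t := by
      simpa using (hasDerivAt_pow 2 t).const_add 1
    refine ((hp.mul (hψ' t).hasDerivAt).add
      (((hasDerivAt_id' t).mul (hψ t).hasDerivAt).const_mul (2 * σ + 1))).congr_deriv ?_
    linarith [hODE t]
  refine ⟨deriv ψ 0, fun t => ?_⟩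
  have hc := is_const_of_deriv_eq_zero (fun t => (hF t).differentiableAt)
    (fun t => (hF t).deriv) t 0
  norm_num at hc
  refine ((hψ t).hasDerivAt.mul (hasDerivAt_one_add_sq_rpow (σ + 1 / 2) t)).congr_deriv ?_
  have hs : (1 + t ^ 2) ^ (σ + 1 / 2) = (1 + t ^ 2) ^ (σ - 1 / 2) * (1 + t ^ 2) := by
    rw [← rpow_add_one (by positivity)]
    ring_nf
  rw [hs, ← hc, show σ + 1 / 2 - 1 = σ - 1 / 2 by ring]
  ring

/-- If σ ∈ (0,1) and ψ : ℝ → ℝ is twice differentiable, solves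
`(1+t²) ψ'' + (2σ+3) t ψ' + (2σ+1) ψ = 0`, and lies in the weighted space
`L²(ℝ, (1+t²)^{σ+1/2} dt)`, then ψ(t) = ψ(0) (1+t²)^{-σ-1/2}. -/
theorem weighted_L2_solution_unique (σ : ℝ) (hσ0 : 0 < σ) (hσ1 : σ < 1) (ψ : ℝ → ℝ)
    (hψ : Differentiable ℝ ψ) (hψ' : Differentiable ℝ (deriv ψ))
    (hODE : ∀ t : ℝ,
      (1 + t^2) * deriv (deriv ψ) t + (2*σ + 3) * t * deriv ψ t + (2*σ + 1) * ψ t = 0)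
    (hL2 : Integrable (fun t : ℝ => (ψ t)^2 * (1 + t^2) ^ (σ + 1/2))) :
    ∀ t : ℝ, ψ t = ψ 0 * (1 + t^2) ^ (-σ - 1/2) := by
  obtain ⟨c, hc⟩ := exists_hasDerivAt_mul_one_add_sq_rpow hψ hψ' hODE
  have hinv : ∀ t : ℝ, (1 + t ^ 2) ^ (σ + 1 / 2) * (1 + t ^ 2) ^ (-σ - 1 / 2) = 1 := by
    intro t
    rw [← rpow_add (by positivity)]
    ring_nf
    exact rpow_zero _
  obtain rfl : c = 0 := by
    by_contra hc0
    refine not_integrable_sq_mul_of_hasDerivAt hσ0 hσ1.le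
      (f := fun t => c⁻¹ * (ψ t * (1 + t ^ 2) ^ (σ + 1 / 2))) (fun t => ?_) ?_
    · simpa [← mul_assoc, hc0] using (hc t).const_mul c⁻¹
    · convert hL2.const_mul (c⁻¹ ^ 2) using 2 with t
      linear_combination c⁻¹ ^ 2 * ψ t ^ 2 * (1 + t ^ 2) ^ (σ + 1 / 2) * hinv t
  intro t
  have hconst := is_const_of_deriv_eq_zero (fun t => (hc t).differentiableAt)
    (fun t => by simpa using (hc t).deriv) t 0
  norm_num at hconst
  have hit := hinv t
  norm_num at hit ⊢
  rw [← hconst, mul_assoc, hit, mul_one]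
end

section
/- Let λ > 0 and σ ∈ (0,1), and define u_{λ,σ}(y) = (λ^σ / Γ(σ)) ∫₀^∞ t^{σ-1} e^{-λt} e^{-y²/(4t)} dt for y > 0. Then u_{λ,σ} is twice differentiable on (0,∞), satisfies the extension equation u''(y) + ((1-2σ)/y)·u'(y) − λ·u(y) = 0 for every y > 0, and lim_{y→0⁺} u_{λ,σ}(y) = 1. -/
open MeasureTheory Real


/-- The integrand `t ^ a * e^{-λt} * e^{-y²/(4t)}` of a modified Bessel integral. -/
noncomputable def besselIntegrand (lam a y t : ℝ) : ℝ :=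
  t ^ a * rexp (-lam * t) * rexp (-y ^ 2 / (4 * t))

lemma besselIntegrand_nonneg (lam a y : ℝ) {t : ℝ} (ht : 0 < t) :
    0 ≤ besselIntegrand lam a y t := by
  unfold besselIntegrand; positivity

lemma measurable_besselIntegrand (lam a y : ℝ) : Measurable (besselIntegrand lam a y) := by
  unfold besselIntegrand; fun_prop

lemma exp_neg_sq_div_le (n : ℕ) {y t : ℝ} (hy : 0 < y) (ht : 0 < t) :
    rexp (-y ^ 2 / (4 * t)) ≤ (n.factorial : ℝ) * (4 / y ^ 2) ^ n * t ^ n := by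
  have h := Real.pow_div_factorial_le_exp (y ^ 2 / (4 * t)) (by positivity) n
  rw [neg_div, Real.exp_neg]
  calc (rexp (y ^ 2 / (4 * t)))⁻¹ ≤ ((y ^ 2 / (4 * t)) ^ n / n.factorial)⁻¹ :=
        inv_anti₀ (by positivity) h
    _ = _ := by
        rw [inv_div, mul_assoc, ← mul_pow, div_eq_mul_inv, ← inv_pow]
        congr 2
        field_simp

lemma besselIntegrand_le (lam a : ℝ) (n : ℕ) {y t : ℝ} (hy : 0 < y) (ht : 0 < t) :
    besselIntegrand lam a y t ≤
      (n.factorial : ℝ) * (4 / y ^ 2) ^ n * (t ^ (a + n) * rexp (-lam * t)) := by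
  rw [rpow_add ht, rpow_natCast]
  calc besselIntegrand lam a y t
      ≤ t ^ a * rexp (-lam * t) * ((n.factorial : ℝ) * (4 / y ^ 2) ^ n * t ^ n) := by
        unfold besselIntegrand
        gcongr
        exact exp_neg_sq_div_le n hy ht
    _ = _ := by ring

lemma integrableOn_rpow_mul_exp_neg_mul {lam s : ℝ} (hlam : 0 < lam) (hs : -1 < s) :
    IntegrableOn (fun t : ℝ => t ^ s * rexp (-lam * t)) (Set.Ioi 0) := by
  simpa using integrableOn_rpow_mul_exp_neg_mul_rpow hs one_pos hlam

lemma integrableOn_besselIntegrand {lam : ℝ} (hlam : 0 < lam) (a : ℝ) {y : ℝ} (hy : 0 < y) :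
    IntegrableOn (besselIntegrand lam a y) (Set.Ioi 0) := by
  obtain ⟨n, hn⟩ := exists_nat_gt (-1 - a)
  refine ((integrableOn_rpow_mul_exp_neg_mul hlam (s := a + n) (by linarith)).const_mul
    ((n.factorial : ℝ) * (4 / y ^ 2) ^ n)).mono'
    (measurable_besselIntegrand lam a y).aestronglyMeasurable ?_
  filter_upwards [ae_restrict_mem measurableSet_Ioi] with t (ht : 0 < t)
  rw [Real.norm_of_nonneg (besselIntegrand_nonneg lam a y ht)]
  exact besselIntegrand_le lam a n hy ht

lemma hasDerivAt_besselIntegrand_param (lam a y : ℝ) {t : ℝ} (ht : 0 < t) :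
    HasDerivAt (fun y => besselIntegrand lam a y t)
      (-(y / 2) * besselIntegrand lam (a - 1) y t) y := by
  have h := ((((hasDerivAt_id y).pow 2).neg.div_const (4 * t)).exp).const_mul
    (t ^ a * rexp (-lam * t))
  convert! h using 1
  unfold besselIntegrand
  rw [rpow_sub_one ht.ne']
  simp
  field_simp
  ring

lemma hasDerivAt_besselIntegrand (lam a y : ℝ) {t : ℝ} (ht : 0 < t) :
    HasDerivAt (besselIntegrand lam a y)
      (a * besselIntegrand lam (a - 1) y t + y ^ 2 / 4 * besselIntegrand lam (a - 2) y t
        - lam * besselIntegrand lam a y t) t := by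
  have h := ((Real.hasDerivAt_rpow_const (p := a) (Or.inl ht.ne')).mul
    (((hasDerivAt_id t).const_mul (-lam)).exp)).mul
    (((hasDerivAt_const t (-y ^ 2)).div ((hasDerivAt_id t).const_mul 4) (by simp [ht.ne'])).exp)
  convert! h using 1
  unfold besselIntegrand
  have h2 : t ^ (a - 2) = t ^ a / t ^ 2 := by
    rw [rpow_sub ht, rpow_two]
  rw [h2, rpow_sub_one ht.ne']
  simp
  field_simp
  ring

lemma hasDerivAt_integral_besselIntegrand {lam : ℝ} (hlam : 0 < lam) (a : ℝ) {y : ℝ}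
    (hy : 0 < y) :
    HasDerivAt (fun y => ∫ t in Set.Ioi (0 : ℝ), besselIntegrand lam a y t)
      (-(y / 2) * ∫ t in Set.Ioi (0 : ℝ), besselIntegrand lam (a - 1) y t) y := by
  rw [← integral_const_mul]
  refine (hasDerivAt_integral_of_dominated_loc_of_deriv_le
    (F' := fun z t => -(z / 2) * besselIntegrand lam (a - 1) z t)
    (bound := fun t => y * besselIntegrand lam (a - 1) (y / 2) t)
    (Ioo_mem_nhds (a := y / 2) (b := 2 * y) (by linarith) (by linarith))
    (.of_forall fun z => (measurable_besselIntegrand lam a z).aestronglyMeasurable)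
    (integrableOn_besselIntegrand hlam a hy)
    ((measurable_besselIntegrand lam (a - 1) y).const_mul _).aestronglyMeasurable
    ?_ ((integrableOn_besselIntegrand hlam (a - 1) (half_pos hy)).const_mul y) ?_).2
  · filter_upwards [ae_restrict_mem measurableSet_Ioi] with t (ht : 0 < t) z hz
    have hz0 : 0 < z := by linarith [hz.1]
    rw [norm_mul, norm_neg, Real.norm_of_nonneg (by positivity),
      Real.norm_of_nonneg (besselIntegrand_nonneg lam (a - 1) z ht)]
    gcongr
    · exact besselIntegrand_nonneg lam (a - 1) z ht
    · linarith [hz.2]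
    · unfold besselIntegrand
      gcongr
      exact hz.1.le
  · filter_upwards [ae_restrict_mem measurableSet_Ioi] with t (ht : 0 < t) z _
    exact hasDerivAt_besselIntegrand_param lam a z ht

lemma tendsto_besselIntegrand_zero (lam a : ℝ) {y : ℝ} (hy : 0 < y) :
    Filter.Tendsto (besselIntegrand lam a y) (nhdsWithin 0 (Set.Ioi 0)) (nhds 0) := by
  obtain ⟨n, hn⟩ := exists_nat_gt (-a)
  have hs : 0 < a + n := by linarith
  have hc : Continuous fun t : ℝ =>
      (n.factorial : ℝ) * (4 / y ^ 2) ^ n * (t ^ (a + n) * rexp (-lam * t)) := by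
    have := Real.continuous_rpow_const hs.le
    fun_prop
  have h := (hc.tendsto 0).mono_left (nhdsWithin_le_nhds (s := Set.Ioi 0))
  simp only [Real.zero_rpow hs.ne', zero_mul, mul_zero] at h
  refine squeeze_zero' ?_ ?_ h
  · filter_upwards [self_mem_nhdsWithin] with t ht using besselIntegrand_nonneg lam a y ht
  · filter_upwards [self_mem_nhdsWithin] with t ht using besselIntegrand_le lam a n hy ht

/-- The three-term recurrence of the Bessel integrals, from integrating a total derivative. -/
lemma integral_besselIntegrand_recurrence {lam : ℝ} (hlam : 0 < lam) (a : ℝ) {y : ℝ}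
    (hy : 0 < y) :
    a * (∫ t in Set.Ioi (0 : ℝ), besselIntegrand lam (a - 1) y t)
      + y ^ 2 / 4 * (∫ t in Set.Ioi (0 : ℝ), besselIntegrand lam (a - 2) y t)
      - lam * (∫ t in Set.Ioi (0 : ℝ), besselIntegrand lam a y t) = 0 := by
  have h0 := integrableOn_besselIntegrand hlam a hy
  have h1 := (integrableOn_besselIntegrand hlam (a - 1) hy).const_mul a
  have h2 := (integrableOn_besselIntegrand hlam (a - 2) hy).const_mul (y ^ 2 / 4)
  have hd : ∀ t ∈ Set.Ioi (0 : ℝ), HasDerivAt (besselIntegrand lam a y) _ t :=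
    fun t ht => hasDerivAt_besselIntegrand lam a y ht
  have hi := (h1.add h2).sub (h0.const_mul lam)
  have hinf := tendsto_zero_of_hasDerivAt_of_integrableOn_Ioi hd hi h0
  have key := integral_Ioi_deriv_mul_eq_sub (v := fun _ => 1) (v' := fun _ => 0) hd
    (fun t _ => hasDerivAt_const t 1)
    (hi.congr (.of_forall fun t => by simp))
    (a' := 0) (b' := 0) (by simpa [Pi.mul_def] using tendsto_besselIntegrand_zero lam a hy)
    (by simpa [Pi.mul_def] using hinf)
  simp only [mul_one, mul_zero, add_zero] at key
  erw [integral_sub (h1.add h2) (h0.const_mul lam), integral_add h1 h2] at key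
  simpa only [integral_const_mul, sub_zero] using key

lemma tendsto_integral_besselIntegrand {lam a : ℝ} (hlam : 0 < lam) (ha : -1 < a) :
    Filter.Tendsto (fun y => ∫ t in Set.Ioi (0 : ℝ), besselIntegrand lam a y t) (nhds 0)
      (nhds (∫ t in Set.Ioi (0 : ℝ), t ^ a * rexp (-lam * t))) := by
  refine tendsto_integral_filter_of_dominated_convergence
    (fun t => t ^ a * rexp (-lam * t))
    (.of_forall fun y => (measurable_besselIntegrand lam a y).aestronglyMeasurable)
    (.of_forall fun y => ?_) (integrableOn_rpow_mul_exp_neg_mul hlam ha) ?_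
  · filter_upwards [ae_restrict_mem measurableSet_Ioi] with t (ht : 0 < t)
    rw [Real.norm_of_nonneg (besselIntegrand_nonneg lam a y ht)]
    refine mul_le_of_le_one_right (by positivity) (Real.exp_le_one_iff.2 ?_)
    rw [neg_div]
    exact neg_nonpos.2 (by positivity)
  · refine .of_forall fun t => ?_
    have hc : Continuous fun y => besselIntegrand lam a y t := by
      unfold besselIntegrand; fun_prop
    simpa [besselIntegrand] using hc.tendsto 0

/-- For λ > 0 and σ ∈ (0,1), the scalar subordinated solution
`u(y) = (λ^σ/Γ(σ)) ∫₀^∞ t^{σ-1} e^{-λt} e^{-y²/(4t)} dt` is twice differentiable on (0,∞),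
satisfies the extension equation `u'' + ((1-2σ)/y) u' - λ u = 0` on (0,∞), and
`u(y) → 1` as `y → 0⁺`. -/
theorem scalar_extension_solution (lam σ : ℝ) (hlam : 0 < lam) (hσ0 : 0 < σ) (hσ1 : σ < 1)
    (u : ℝ → ℝ)
    (hu : ∀ y : ℝ, u y = (lam ^ σ / Real.Gamma σ) *
      ∫ t in Set.Ioi (0:ℝ), t ^ (σ - 1) * Real.exp (-lam * t) * Real.exp (-y^2 / (4*t))) :
    (∀ y : ℝ, 0 < y → DifferentiableAt ℝ u y) ∧
    (∀ y : ℝ, 0 < y → DifferentiableAt ℝ (deriv u) y) ∧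
    (∀ y : ℝ, 0 < y →
      deriv (deriv u) y + ((1 - 2*σ)/y) * deriv u y - lam * u y = 0) ∧
    Filter.Tendsto u (nhdsWithin 0 (Set.Ioi 0)) (nhds 1) := by
  set c := lam ^ σ / Real.Gamma σ with hc
  set K : ℝ → ℝ → ℝ := fun a y => ∫ t in Set.Ioi (0 : ℝ), besselIntegrand lam a y t with hK
  have huK : u = fun y => c * K (σ - 1) y := funext hu
  have hKd (a : ℝ) {y : ℝ} (hy : 0 < y) : HasDerivAt (K a) (-(y / 2) * K (a - 1) y) y :=
    hasDerivAt_integral_besselIntegrand hlam a hy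
  have hu1 {y : ℝ} (hy : 0 < y) : HasDerivAt u (c * (-(y / 2) * K (σ - 1 - 1) y)) y := by
    rw [huK]
    exact (hKd _ hy).const_mul c
  have hu2 {y : ℝ} (hy : 0 < y) : HasDerivAt (deriv u)
      (c * (-(1 / 2) * K (σ - 1 - 1) y + -(y / 2) * (-(y / 2) * K (σ - 1 - 1 - 1) y))) y := by
    have h := ((((hasDerivAt_id y).div_const 2).neg).mul (hKd (σ - 1 - 1) hy)).const_mul c
    refine h.congr_of_eventuallyEq ?_
    filter_upwards [lt_mem_nhds hy] with z hz using (hu1 hz).deriv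
  refine ⟨fun y hy => (hu1 hy).differentiableAt, fun y hy => (hu2 hy).differentiableAt,
    fun y hy => ?_, ?_⟩
  · have h := integral_besselIntegrand_recurrence hlam (σ - 1) hy
    rw [show σ - 1 - 2 = σ - 1 - 1 - 1 by ring] at h
    rw [(hu2 hy).deriv, (hu1 hy).deriv, huK]
    field_simp
    linear_combination 4 * c * h
  · have h := ((tendsto_integral_besselIntegrand (a := σ - 1) hlam (by linarith)).const_mul
      c).mono_left (nhdsWithin_le_nhds (s := Set.Ioi 0))
    have hG := Real.integral_rpow_mul_exp_neg_mul_Ioi hσ0 hlam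
    simp only [← neg_mul] at hG
    rw [hG, hc, one_div, Real.inv_rpow hlam.le] at h
    rw [huK]
    convert h using 2
    have := Real.Gamma_pos_of_pos hσ0
    have := Real.rpow_pos_of_pos hlam σ
    field_simp
end

section
/- Let λ > 0 and σ ∈ (0,1), and define u_{λ,σ}(y) = (λ^σ / Γ(σ)) ∫₀^∞ t^{σ-1} e^{-λt} e^{-y²/(4t)} dt for y > 0. Then lim_{y→0⁺} y^{1-2σ} u_{λ,σ}'(y) = −2^{1-2σ} (Γ(1-σ)/Γ(σ)) λ^σ; equivalently, −2^{2σ-1} (Γ(σ)/Γ(1-σ)) · lim_{y→0⁺} y^{1-2σ} u_{λ,σ}'(y) = λ^σ. -/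
open MeasureTheory Real Set Filter Topology

/-- The Gamma integral after the substitution `s = 1 / r`. -/
lemma integral_rpow_mul_exp_neg_inv (σ : ℝ) (hσ1 : σ < 1) :
    ∫ r in Ioi (0 : ℝ), r ^ (σ - 2) * exp (-r⁻¹) = Gamma (1 - σ) := by
  rw [Gamma_eq_integral (by linarith),
    ← integral_comp_rpow_Ioi (fun s ↦ exp (-s) * s ^ (1 - σ - 1)) (p := -1) (by norm_num)]
  refine setIntegral_congr_fun measurableSet_Ioi fun r (hr : 0 < r) ↦ ?_
  simp only [abs_neg, abs_one, one_mul, smul_eq_mul]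
  rw [← rpow_mul hr.le, rpow_neg_one, mul_left_comm, ← rpow_add hr, mul_comm]
  ring_nf

lemma integrableOn_rpow_mul_exp_neg_inv (σ : ℝ) (hσ1 : σ < 1) :
    IntegrableOn (fun r : ℝ ↦ r ^ (σ - 2) * exp (-r⁻¹)) (Ioi 0) :=
  .of_integral_ne_zero <| by
    rw [integral_rpow_mul_exp_neg_inv σ hσ1]
    exact (Gamma_pos_of_pos (by linarith)).ne'

lemma integrableOn_rpow_mul_exp_neg_mul_s13 (lam σ : ℝ) (hlam : 0 < lam) (hσ0 : 0 < σ) :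
    IntegrableOn (fun t : ℝ ↦ t ^ (σ - 1) * exp (-lam * t)) (Ioi 0) :=
  .of_integral_ne_zero <| by
    simp only [neg_mul]
    rw [integral_rpow_mul_exp_neg_mul_Ioi hσ0 hlam]
    have := Gamma_pos_of_pos hσ0
    positivity

/-- Differentiation under the integral sign in the subordination formula. -/
lemma hasDerivAt_subordination_integral (lam σ : ℝ) (hlam : 0 < lam) (hσ0 : 0 < σ)
    {y : ℝ} (hy : 0 < y) :
    HasDerivAt
      (fun x : ℝ ↦ ∫ t in Ioi (0 : ℝ), t ^ (σ - 1) * exp (-lam * t) * exp (-x ^ 2 / (4 * t)))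
      (∫ t in Ioi (0 : ℝ), t ^ (σ - 1) * exp (-lam * t) *
        (exp (-y ^ 2 / (4 * t)) * (-(2 * y) / (4 * t)))) y := by
  have hint := integrableOn_rpow_mul_exp_neg_mul_s13 lam σ hlam hσ0
  refine (hasDerivAt_integral_of_dominated_loc_of_deriv_le (Ioi_mem_nhds (half_lt_self hy))
    (F' := fun x t ↦ t ^ (σ - 1) * exp (-lam * t) *
      (exp (-x ^ 2 / (4 * t)) * (-(2 * x) / (4 * t))))
    (bound := fun t ↦ t ^ (σ - 1) * exp (-lam * t) * (4 / y)) ?_ ?_ ?_ ?_ ?_ ?_).2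
  · exact .of_forall fun x ↦ (by fun_prop : Measurable _).aestronglyMeasurable
  · refine Integrable.mono' hint (by fun_prop : Measurable _).aestronglyMeasurable ?_
    filter_upwards [ae_restrict_mem measurableSet_Ioi] with t (ht : 0 < t)
    rw [norm_of_nonneg (by positivity)]
    refine mul_le_of_le_one_right (by positivity) (exp_le_one_iff.2 ?_)
    exact div_nonpos_of_nonpos_of_nonneg (by nlinarith) (by positivity)
  · exact (by fun_prop : Measurable _).aestronglyMeasurable
  · filter_upwards [ae_restrict_mem measurableSet_Ioi] with t (ht : 0 < t) x (hx : y / 2 < x)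
    have hx0 : 0 < x := by linarith
    rw [norm_mul, norm_of_nonneg (by positivity : 0 ≤ t ^ (σ - 1) * exp (-lam * t)), norm_mul,
      norm_of_nonneg (exp_pos _).le, neg_div _ (2 * x), norm_neg,
      norm_of_nonneg (by positivity : 0 ≤ 2 * x / (4 * t))]
    refine mul_le_mul_of_nonneg_left ?_ (by positivity)
    have hz : x ^ 2 / (4 * t) * exp (-x ^ 2 / (4 * t)) ≤ 1 := by
      rw [neg_div, exp_neg, ← div_eq_mul_inv, div_le_one (exp_pos _)]
      linarith [add_one_le_exp (x ^ 2 / (4 * t))]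
    calc exp (-x ^ 2 / (4 * t)) * (2 * x / (4 * t))
        = 2 / x * (x ^ 2 / (4 * t) * exp (-x ^ 2 / (4 * t))) := by field_simp
      _ ≤ 2 / x := mul_le_of_le_one_right (by positivity) hz
      _ ≤ 4 / y := by rw [div_le_div_iff₀ hx0 hy]; linarith
  · exact hint.mul_const _
  · refine .of_forall fun t x _ ↦ ?_
    have h : HasDerivAt (fun x : ℝ ↦ -x ^ 2 / (4 * t)) (-(2 * x) / (4 * t)) x := by
      simpa using ((hasDerivAt_pow 2 x).neg).div_const (4 * t)
    exact h.exp.const_mul _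

/-- The rescaling `t = (y² / 4) r` in the differentiated subordination formula. -/
lemma rpow_mul_integral_subordination_deriv (lam σ : ℝ) {y : ℝ} (hy : 0 < y) :
    y ^ (1 - 2 * σ) * ∫ t in Ioi (0 : ℝ), t ^ (σ - 1) * exp (-lam * t) *
        (exp (-y ^ 2 / (4 * t)) * (-(2 * y) / (4 * t))) =
      -(2 : ℝ) ^ (1 - 2 * σ) *
        ∫ r in Ioi (0 : ℝ), r ^ (σ - 2) * exp (-r⁻¹) * exp (-lam * (y ^ 2 / 4 * r)) := by
  have hc : 0 < y ^ 2 / 4 := by positivity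
  have hsub := integral_comp_mul_left_Ioi (fun t ↦ t ^ (σ - 1) * exp (-lam * t) *
    (exp (-y ^ 2 / (4 * t)) * (-(2 * y) / (4 * t)))) 0 hc
  rw [mul_zero, eq_inv_smul_iff₀ hc.ne'] at hsub
  rw [← hsub, smul_eq_mul, ← integral_const_mul, ← integral_const_mul, ← integral_const_mul]
  refine setIntegral_congr_fun measurableSet_Ioi fun r (hr : 0 < r) ↦ ?_
  have hexp : -y ^ 2 / (4 * (y ^ 2 / 4 * r)) = -r⁻¹ := by field_simp
  have hpow : y ^ (1 - 2 * σ) * (y ^ 2 / 4 * r) ^ (σ - 1) * y =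
      2 * (2 : ℝ) ^ (1 - 2 * σ) * (r * r ^ (σ - 2)) := by
    have h1 : (y ^ 2 / 4 * r) ^ (σ - 1) = y ^ (2 * (σ - 1)) / 2 ^ (2 * (σ - 1)) * r ^ (σ - 1) := by
      rw [mul_rpow hc.le hr.le, show y ^ 2 / 4 = (y / 2) ^ (2 : ℝ) by rw [rpow_two]; ring,
        ← rpow_mul (by positivity), div_rpow hy.le (by norm_num)]
    have h2 : y ^ (1 - 2 * σ) * y ^ (2 * (σ - 1)) * y = 1 := by
      nth_rw 3 [← rpow_one y]
      rw [← rpow_add hy, ← rpow_add hy]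
      ring_nf
      exact rpow_zero y
    have h3 : ((2 : ℝ) ^ (2 * (σ - 1)))⁻¹ = 2 * 2 ^ (1 - 2 * σ) := by
      rw [← rpow_neg (by norm_num)]
      calc (2 : ℝ) ^ (-(2 * (σ - 1))) = 2 ^ (1 + (1 - 2 * σ)) := by ring_nf
        _ = 2 * 2 ^ (1 - 2 * σ) := by rw [rpow_add two_pos, rpow_one]
    have h4 : r * r ^ (σ - 2) = r ^ (σ - 1) := by
      nth_rw 1 [← rpow_one r]
      rw [← rpow_add hr]
      ring_nf
    rw [h1, h4, div_eq_mul_inv, h3]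
    linear_combination 2 * (2 : ℝ) ^ (1 - 2 * σ) * r ^ (σ - 1) * h2
  simp only [hexp]
  have : -(2 * y) / (4 * (y ^ 2 / 4 * r)) * (y ^ 2 / 4) = - y / (2 * r) := by
    field_simp
    ring
  calc _ = (y ^ (1 - 2 * σ) * (y ^ 2 / 4 * r) ^ (σ - 1)) * exp (-lam * (y ^ 2 / 4 * r)) *
        exp (-r⁻¹) * (-(2 * y) / (4 * (y ^ 2 / 4 * r)) * (y ^ 2 / 4)) := by ring
    _ = (y ^ (1 - 2 * σ) * (y ^ 2 / 4 * r) ^ (σ - 1) * y) * exp (-lam * (y ^ 2 / 4 * r)) *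
        exp (-r⁻¹) * (-1 / (2 * r)) := by rw [this]; ring
    _ = _ := by rw [hpow]; field_simp

lemma tendsto_integral_rpow_mul_exp_neg_inv (lam σ : ℝ) (hlam : 0 < lam) (hσ1 : σ < 1) :
    Tendsto (fun y : ℝ ↦
        ∫ r in Ioi (0 : ℝ), r ^ (σ - 2) * exp (-r⁻¹) * exp (-lam * (y ^ 2 / 4 * r)))
      (𝓝 0) (𝓝 (Gamma (1 - σ))) := by
  rw [← integral_rpow_mul_exp_neg_inv σ hσ1]
  refine tendsto_integral_filter_of_dominated_convergence _
    (.of_forall fun y ↦ (by fun_prop : Measurable _).aestronglyMeasurable)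
    (.of_forall fun y ↦ ?_) (integrableOn_rpow_mul_exp_neg_inv σ hσ1) (.of_forall fun r ↦ ?_)
  · filter_upwards [ae_restrict_mem measurableSet_Ioi] with r (hr : 0 < r)
    rw [norm_of_nonneg (by positivity)]
    refine mul_le_of_le_one_right (by positivity) (exp_le_one_iff.2 ?_)
    rw [neg_mul]
    exact neg_nonpos.2 (by positivity)
  · have h : Continuous fun y : ℝ ↦
        r ^ (σ - 2) * exp (-r⁻¹) * exp (-lam * (y ^ 2 / 4 * r)) := by fun_prop
    simpa using h.tendsto 0

/-- For λ > 0 and σ ∈ (0,1), the scalar subordinated solution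
`u(y) = (λ^σ/Γ(σ)) ∫₀^∞ t^{σ-1} e^{-λt} e^{-y²/(4t)} dt` satisfies the Neumann-limit
identity `lim_{y→0⁺} y^{1-2σ} u'(y) = -2^{1-2σ} (Γ(1-σ)/Γ(σ)) λ^σ`. -/
theorem scalar_neumann_limit (lam σ : ℝ) (hlam : 0 < lam) (hσ0 : 0 < σ) (hσ1 : σ < 1)
    (u : ℝ → ℝ)
    (hu : ∀ y : ℝ, u y = (lam ^ σ / Real.Gamma σ) *
      ∫ t in Set.Ioi (0:ℝ), t ^ (σ - 1) * Real.exp (-lam * t) * Real.exp (-y^2 / (4*t))) :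
    Filter.Tendsto (fun y : ℝ => y ^ (1 - 2*σ) * deriv u y) (nhdsWithin 0 (Set.Ioi 0))
      (nhds (-(2 : ℝ) ^ (1 - 2*σ) * (Real.Gamma (1 - σ) / Real.Gamma σ) * lam ^ σ)) := by
  have hlim := ((tendsto_integral_rpow_mul_exp_neg_inv lam σ hlam hσ1).mono_left
    (nhdsWithin_le_nhds (s := Ioi 0))).const_mul
      (lam ^ σ / Gamma σ * -(2 : ℝ) ^ (1 - 2 * σ))
  convert hlim.congr' ?_ using 2
  · ring
  · filter_upwards [self_mem_nhdsWithin] with y (hy : 0 < y)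
    rw [funext hu, ((hasDerivAt_subordination_integral lam σ hlam hσ0 hy).const_mul _).deriv,
      mul_assoc, ← rpow_mul_integral_subordination_deriv lam σ hy]
    ring
end

section
/- Let n ≥ 1 be an integer, let σ ∈ (0,1), and let q be a real number with 1 < q < (n+1)/n. Then the double integral ∫₀¹ ∫₀¹ y^{2σq} (r² + y²)^{-(n/2+σ)q} r^{n-1} dr dy is finite. -/
open MeasureTheory Real

lemma rpow_mul_add_sq_rpow_mul_rpow_le {r y a b s t : ℝ} (hr : 0 < r) (hy : 0 < y)
    (ha : 0 ≤ a) (hb : 0 ≤ b) :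
    y ^ s * (r ^ 2 + y ^ 2) ^ (-(a + b)) * r ^ t ≤ y ^ (s - 2 * a) * r ^ (t - 2 * b) := by
  have hpow : ∀ {x c : ℝ}, 0 < x → (x ^ 2) ^ (-c) = x ^ (-(2 * c)) := fun hx ↦ by
    rw [← rpow_natCast, ← rpow_mul hx.le]
    push_cast
    ring_nf
  have key : (r ^ 2 + y ^ 2) ^ (-(a + b)) ≤ y ^ (-(2 * a)) * r ^ (-(2 * b)) := by
    rw [neg_add, rpow_add (by positivity), ← hpow hy, ← hpow hr]
    gcongr ?_ * ?_
    · exact rpow_le_rpow_of_nonpos (by positivity) (by nlinarith) (by linarith)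
    · exact rpow_le_rpow_of_nonpos (by positivity) (by nlinarith) (by linarith)
  calc y ^ s * (r ^ 2 + y ^ 2) ^ (-(a + b)) * r ^ t
      ≤ y ^ s * (y ^ (-(2 * a)) * r ^ (-(2 * b))) * r ^ t := by gcongr
    _ = y ^ (s - 2 * a) * r ^ (t - 2 * b) := by
      rw [sub_eq_add_neg, sub_eq_add_neg, rpow_add hy, rpow_add hr]
      ring

lemma integrableOn_rpow_mul_rpow_Ioo_prod {s t : ℝ} (hs : -1 < s) (ht : -1 < t) :
    IntegrableOn (fun p : ℝ × ℝ => p.1 ^ s * p.2 ^ t)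
      (Set.Ioo (0 : ℝ) 1 ×ˢ Set.Ioo (0 : ℝ) 1) := by
  have h : ∀ {u : ℝ}, -1 < u → IntegrableOn (fun x : ℝ => x ^ u) (Set.Ioo 0 1) := fun hu ↦
    (intervalIntegral.integrableOn_Ioo_rpow_iff one_pos).2 hu
  rw [IntegrableOn, Measure.volume_eq_prod, ← Measure.prod_restrict]
  exact (h hs).mul_prod (h ht)

/-- For an integer n ≥ 1, σ ∈ (0,1) and 1 < q < (n+1)/n, the double integral
`∫₀¹ ∫₀¹ y^{2σq} (r²+y²)^{-(n/2+σ)q} r^{n-1} dr dy` is finite. -/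
theorem local_Lq_integrability (n : ℕ) (hn : 1 ≤ n) (σ q : ℝ) (hσ0 : 0 < σ) (hσ1 : σ < 1)
    (hq1 : 1 < q) (hq2 : q < ((n : ℝ) + 1) / n) :
    IntegrableOn
      (fun p : ℝ × ℝ =>
        p.1 ^ (2*σ*q) * (p.2^2 + p.1^2) ^ (-((n : ℝ)/2 + σ) * q) * p.2 ^ ((n : ℝ) - 1))
      (Set.Ioo (0:ℝ) 1 ×ˢ Set.Ioo (0:ℝ) 1) := by
  have hn' : (1 : ℝ) ≤ n := by exact_mod_cast hn
  rw [lt_div_iff₀ (by linarith)] at hq2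
  obtain ⟨ε, hε⟩ : ∃ ε : ℝ, ε = (n + 1 - q * n) / 4 := ⟨_, rfl⟩
  have hε0 : 0 < ε := by linarith
  have hε1 : ε < 1 / 4 := by nlinarith
  have hσq : 0 < σ * q := by positivity
  refine Integrable.mono' (integrableOn_rpow_mul_rpow_Ioo_prod
    (s := 2 * σ * q - 2 * (σ * q + 1 / 2 - ε)) (t := n - 1 - 2 * (n / 2 - ε))
    (by linarith) (by linarith)) (by fun_prop) ?_
  filter_upwards [ae_restrict_mem (measurableSet_Ioo.prod measurableSet_Ioo)]
    with p ⟨⟨hy, _⟩, hr, _⟩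
  rw [norm_of_nonneg (by positivity),
    show -((n : ℝ) / 2 + σ) * q = -((σ * q + 1 / 2 - ε) + (n / 2 - ε)) by rw [hε]; ring]
  exact rpow_mul_add_sq_rpow_mul_rpow_le hr hy (by linarith) (by linarith)
end
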